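/- Let F ∈ S^♯♭(σ0,σ1), and let τ ≥ σ1 be a real number such that 0 ∉ Z(F) and τ ∉ Z(F). Then for every positive integer n, the family (ord(ρ)·Re(1 − (ρ/(ρ−τ))^n))_{ρ∈Z(F)} is absolutely summable and Re(λ_F(n,τ)) = ∑_{ρ∈Z(F)} ord(ρ)·Re(1 − (ρ/(ρ−τ))^n). -/

import Mathlib

open Complex Filter MeasureTheory Finset

noncomputable section

/-- The order of vanishing of `f` at `ρ`. -/
noncomputable def zeroOrder (f : ℂ → ℂ) (ρ : ℂ) : ℕ :=
  sInf {k : ℕ | iteratedDeriv k f ρ ≠ 0}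

/-- The class `S^♯♭(σ₀,σ₁)` of `L`-functions. -/
structure SSF (σ0 σ1 : ℝ) : Type where
  hσ1pos : 0 < σ1
  hσ : σ1 ≤ σ0
  /-- The `L`-function itself (as a function, analytic away from the poles). -/
  F : ℂ → ℂ
  /-- Dirichlet series coefficients. -/
  a : ℕ → ℂ
  hDir : ∀ s : ℂ, σ0 < s.re →
    HasSum (fun n : ℕ => a (n + 1) * ((n + 1 : ℕ) : ℂ) ^ (-s)) (F s)
  hDirAbs : ∀ s : ℂ, σ0 < s.re →
    Summable (fun n : ℕ => ‖a (n + 1) * ((n + 1 : ℕ) : ℂ) ^ (-s)‖)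
  /-- The number of poles. -/
  N : ℕ
  /-- The poles `s₁, …, s_N`. -/
  pole : Fin N → ℂ
  /-- Their orders `m₁, …, m_N`. -/
  m : Fin N → ℕ
  hm : ∀ i, 0 < m i
  /-- Entire continuation of `∏ (s - sᵢ)^{mᵢ} · F s`, of finite order. -/
  G : ℂ → ℂ
  hGdiff : Differentiable ℂ G
  hGord : ∃ c B : ℝ, ∀ s : ℂ, ‖G s‖ ≤ c * Real.exp (‖s‖ ^ B)
  hGF : ∀ s : ℂ, (∀ i, s ≠ pole i) → G s = (∏ i, (s - pole i) ^ m i) * F s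
  Q : ℝ
  hQ : 0 < Q
  r : ℕ
  lam : Fin r → ℝ
  hlam : ∀ j, 0 < lam j
  mu : Fin r → ℂ
  ω : ℂ
  hω : ‖ω‖ = 1
  M : ℕ
  /-- `δ(σ₁) ∈ {0,1}`. -/
  dlt : ℕ
  hdlt : dlt ≤ 1
  hMN : 2 * M + dlt ≤ N
  hpair : ∀ (j : ℕ) (h1 : 2 * j < N) (h2 : 2 * j + 1 < N), j < M →
    pole ⟨2 * j, h1⟩ + (starRingEnd ℂ) (pole ⟨2 * j + 1, h2⟩) = (σ1 : ℂ)
  hdelta : dlt = 1 ↔ ∃ i, pole i = (σ1 / 2 : ℂ)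
  hdeltaPos : dlt = 1 → ∀ h2 : 2 * M < N, pole ⟨2 * M, h2⟩ = (σ1 / 2 : ℂ)
  /-- The completed function `ξ_F` (the analytic continuation of the completed product). -/
  xi : ℂ → ℂ
  hxiDiff : Differentiable ℂ xi
  hxiEq : ∀ s : ℂ, (∀ i, s ≠ pole i) →
    (∀ (j : Fin r) (k : ℕ), (lam j : ℂ) * s + mu j ≠ -(k : ℂ)) →
    xi s = F s * (Q : ℂ) ^ s * (∏ j, Complex.Gamma ((lam j : ℂ) * s + mu j)) *
      (∏ i, (s - pole i) ^ m i) *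
      ∏ i : Fin N, (if 2 * M + dlt ≤ (i : ℕ) then ((σ1 : ℂ) - s - (starRingEnd ℂ) (pole i)) ^ m i else 1)
  hFE : ∀ s : ℂ, xi s = ω * (starRingEnd ℂ) (xi ((σ1 : ℂ) - (starRingEnd ℂ) s))
  /-- The coefficients of the Dirichlet series of `-F'/F`. -/
  c : ℕ → ℂ
  hEuler : ∀ s : ℂ, σ0 < s.re →
    HasSum (fun n : ℕ => c (n + 2) * ((n + 2 : ℕ) : ℂ) ^ (-s)) (-(deriv F s / F s))
  hEulerAbs : ∀ s : ℂ, σ0 < s.re →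
    Summable (fun n : ℕ => ‖c (n + 2) * ((n + 2 : ℕ) : ℂ) ^ (-s)‖)

namespace SSF

variable {σ0 σ1 : ℝ}

/-- Truncated sum over the nontrivial zeros (zeros of `ξ_F`) with `|Im ρ| ≤ T`,
counted with multiplicity. -/
noncomputable def zsum (S : SSF σ0 σ1) (w : ℂ → ℂ) (T : ℝ) : ℂ :=
  ∑' ρ : {ρ : ℂ // S.xi ρ = 0 ∧ |ρ.im| ≤ T}, (zeroOrder S.xi ρ : ℂ) * w ρ

end SSF

lemma zeroOrder_eq_analyticOrderNatAt {f : ℂ → ℂ} {ρ : ℂ} (hf : AnalyticAt ℂ f ρ)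
    (h : analyticOrderAt f ρ ≠ ⊤) : zeroOrder f ρ = analyticOrderNatAt f ρ := by
  obtain ⟨h1, h2⟩ := (analyticOrderAt_eq_nat_iff_iteratedDeriv_eq_zero hf).1
    (Nat.cast_analyticOrderNatAt h).symm
  refine le_antisymm (Nat.sInf_le h2) ?_
  refine le_csInf ⟨_, h2⟩ fun k hk => ?_
  by_contra! hlt
  exact hk (h1 k hlt)

/-- The zeros of an entire function in a closed disc, counted with multiplicity, are bounded in
number by Jensen's inequality. -/
lemma sum_zeroOrder_le {f : ℂ → ℂ} (hf : Differentiable ℂ f) (h0 : f 0 ≠ 0) {r B : ℝ}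
    (hr : 0 < r) (hB : 1 ≤ B) (hbd : ∀ s : ℂ, ‖s‖ ≤ 2 * r → ‖f s‖ ≤ B) (u : Finset ℂ)
    (hu : ∀ ρ ∈ u, ‖ρ‖ ≤ r) :
    ∑ ρ ∈ u, (zeroOrder f ρ : ℝ) ≤ Real.log (B / ‖f 0‖) / Real.log 2 := by
  have hA : ∀ z, AnalyticAt ℂ f z := fun z => hf.analyticAt z
  have hnt : ∀ z, analyticOrderAt f z ≠ ⊤ := by
    intro z hz
    rw [AnalyticOnNhd.analyticOrderAt_eq_top_iff_eq_zero z hA] at hz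
    exact h0 (by simp [hz])
  have hAn : AnalyticOnNhd ℂ f (Metric.closedBall 0 |r|) := fun z _ => hA z
  have key := AnalyticOnNhd.sum_divisor_le (c := 0) (r := r) (R := 2 * r) (M := B) (f := f)
    (by positivity) (by rw [abs_of_pos hr, abs_of_pos (by positivity)]; linarith) hB
    (fun z _ => hA z) h0 (fun z hz => hbd z (by
      simp only [mem_sphere_iff_norm, sub_zero] at hz
      rw [hz, abs_of_pos (by positivity)]))
  rw [mul_div_assoc, div_self hr.ne', mul_one] at key
  refine le_trans ?_ key
  have hdiv : ∀ ρ ∈ u, (zeroOrder f ρ : ℤ) =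
      MeromorphicOn.divisor f (Metric.closedBall 0 |r|) ρ := by
    intro ρ hρ
    rw [MeromorphicOn.AnalyticOnNhd.divisor_apply hAn (by simpa [abs_of_pos hr] using hu ρ hρ),
      zeroOrder_eq_analyticOrderNatAt (hA ρ) (hnt ρ)]
    conv_rhs => rw [← Nat.cast_analyticOrderNatAt (hnt ρ)]
    simp
  have hfin := (MeromorphicOn.divisor f (Metric.closedBall 0 |r|)).finiteSupport
    (isCompact_closedBall 0 |r|)
  rw [finsum_eq_sum_of_support_subset (s := hfin.toFinset ∪ u) _ (by
    intro x hx; simp; left; simpa using hx)]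
  have : (∑ ρ ∈ u, (zeroOrder f ρ : ℤ)) ≤
      ∑ ρ ∈ hfin.toFinset ∪ u, MeromorphicOn.divisor f (Metric.closedBall 0 |r|) ρ := by
    rw [Finset.sum_congr rfl hdiv]
    exact Finset.sum_le_sum_of_subset_of_nonneg Finset.subset_union_right
      fun i _ _ => MeromorphicOn.AnalyticOnNhd.divisor_nonneg hAn i
  exact_mod_cast this

/-- For an entire function of order less than `2`, the sum of `ord(ρ) / (1 + |ρ|) ^ 2` over the
zeros converges. -/
lemma summable_zeroOrder_div {f : ℂ → ℂ} (hf : Differentiable ℂ f) (h0 : f 0 ≠ 0) {A α : ℝ}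
    (hA : 0 ≤ A) (hα0 : 0 ≤ α) (hα : α < 2)
    (hbd : ∀ s : ℂ, ‖f s‖ ≤ Real.exp (A * (1 + ‖s‖) ^ α)) :
    Summable fun ρ : {ρ : ℂ // f ρ = 0} => (zeroOrder f ρ : ℝ) / (1 + ‖(ρ : ℂ)‖) ^ 2 := by
  have hlog2 : 0 < Real.log 2 := Real.log_pos one_lt_two
  set q : ℝ := 2 ^ α / 4 with hq
  have hq0 : 0 ≤ q := by positivity
  have hq1 : q < 1 := by
    rw [hq, div_lt_one (by norm_num)]
    calc (2 : ℝ) ^ α < 2 ^ (2 : ℝ) := Real.rpow_lt_rpow_of_exponent_lt one_lt_two hα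
      _ = 4 := by norm_num
  set D : ℝ := (A * 8 ^ α + |Real.log ‖f 0‖|) / Real.log 2 with hD
  have hD0 : 0 ≤ D := by positivity
  have hcount : ∀ (k : ℕ) (u : Finset ℂ), (∀ ρ ∈ u, ‖ρ‖ ≤ 2 ^ (k + 1)) →
      ∑ ρ ∈ u, (zeroOrder f ρ : ℝ) ≤ D * (2 ^ α) ^ k := by
    intro k u hu
    have h1 : (1 : ℝ) ≤ (2 ^ α) ^ k := one_le_pow₀ (Real.one_le_rpow one_le_two hα0)
    have h2k : (1 : ℝ) ≤ 2 ^ k := one_le_pow₀ one_le_two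
    refine (sum_zeroOrder_le hf h0 (r := 2 ^ (k + 1))
      (B := Real.exp (A * (8 ^ α * (2 ^ α) ^ k))) (by positivity)
      (Real.one_le_exp (by positivity)) ?_ u hu).trans ?_
    · intro s hs
      refine (hbd s).trans ?_
      gcongr
      calc (1 + ‖s‖) ^ α ≤ (8 * 2 ^ k) ^ α := by
            gcongr
            rw [pow_succ] at hs
            linarith
        _ = 8 ^ α * (2 ^ α) ^ k := by
            rw [Real.mul_rpow (by norm_num) (by positivity), ← Real.rpow_natCast,
              ← Real.rpow_natCast, ← Real.rpow_mul (by norm_num), ← Real.rpow_mul (by norm_num),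
              mul_comm (k : ℝ)]
    · rw [Real.log_div (Real.exp_pos _).ne' (by simpa using h0), Real.log_exp, hD,
        div_mul_eq_mul_div]
      gcongr
      rw [add_mul, ← mul_assoc, sub_eq_add_neg]
      gcongr
      exact (neg_le_abs _).trans (le_mul_of_one_le_right (abs_nonneg _) h1)
  have hgeo : Summable fun k : ℕ => D * q ^ k :=
    (summable_geometric_of_lt_one hq0 hq1).mul_left D
  choose κ hκ1 hκ2 using fun x : {ρ : ℂ // f ρ = 0} =>
    exists_nat_pow_near (x := 1 + ‖(x : ℂ)‖) (y := 2) (by linarith [norm_nonneg (x : ℂ)])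
      one_lt_two
  refine summable_of_sum_le (c := ∑' k, D * q ^ k) (fun _ => by positivity) fun u => ?_
  rw [← Finset.sum_fiberwise_of_maps_to (t := u.image κ) (g := κ)
    (fun x hx => Finset.mem_image_of_mem κ hx)]
  refine le_trans (Finset.sum_le_sum fun k _ => ?_)
    (hgeo.sum_le_tsum (u.image κ) fun k _ => by positivity)
  have hsum := hcount k ((u.filter fun x => κ x = k).map (Function.Embedding.subtype _)) (by
    intro ρ hρ
    simp only [Finset.mem_map, Finset.mem_filter, Function.Embedding.subtype_apply] at hρ
    obtain ⟨x, ⟨-, hx⟩, rfl⟩ := hρ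
    have := hκ2 x
    rw [hx] at this
    linarith)
  rw [Finset.sum_map] at hsum
  calc ∑ x ∈ u with κ x = k, (zeroOrder f x : ℝ) / (1 + ‖(x : ℂ)‖) ^ 2
      ≤ ∑ x ∈ u with κ x = k, (zeroOrder f x : ℝ) * (1 / 4 ^ k) := by
        refine Finset.sum_le_sum fun x hx => ?_
        rw [div_eq_mul_one_div]
        have h4 : (4 : ℝ) ^ k = (2 ^ k) ^ 2 := by rw [← pow_mul, mul_comm, pow_mul]; norm_num
        have := hκ1 x
        rw [(Finset.mem_filter.1 hx).2] at this
        rw [h4]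
        gcongr
    _ ≤ D * q ^ k := by
        rw [← Finset.sum_mul, hq, div_pow, mul_one_div, ← mul_div_assoc]
        gcongr
        exact hsum

/-- A function with a bounded logarithmic derivative near `z` has no zero at `z`, unless it
vanishes identically near `z`. -/
lemma ne_zero_of_norm_deriv_div_le {f : ℂ → ℂ} {z : ℂ} {B : ℝ} (hf : AnalyticAt ℂ f z)
    (hne : ¬ ∀ᶠ w in nhds z, f w = 0) (hB : ∀ᶠ w in nhds z, ‖deriv f w / f w‖ ≤ B) :
    f z ≠ 0 := by
  intro hz
  have hnt : analyticOrderAt f z ≠ ⊤ := by rwa [Ne, analyticOrderAt_eq_top]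
  obtain ⟨n, hn⟩ : ∃ n : ℕ, analyticOrderAt f z = n + 1 := by
    have h1 : analyticOrderNatAt f z ≠ 0 := by
      intro h
      have := Nat.cast_analyticOrderNatAt hnt
      rw [h] at this
      exact (hf.analyticOrderAt_ne_zero.2 hz) this.symm
    obtain ⟨n, hn⟩ := Nat.exists_eq_succ_of_ne_zero h1
    exact ⟨n, by rw [← Nat.cast_analyticOrderNatAt hnt, hn]; push_cast; rfl⟩
  obtain ⟨g, hg, -, hfg⟩ := (hf.analyticOrderAt_eq_natCast (n := n + 1)).1 (by exact_mod_cast hn)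
  obtain ⟨h, hh, hh0, hfh⟩ := (hf.deriv.analyticOrderAt_eq_natCast (n := n)).1
    (analyticOrderAt_deriv_of_pos hf hn)
  have hfne : ∀ᶠ w in nhdsWithin z {z}ᶜ, f w ≠ 0 :=
    (hf.eventually_eq_zero_or_eventually_ne_zero).resolve_left hne
  have hle : ∀ᶠ w in nhdsWithin z {z}ᶜ, ‖h w‖ ≤ B * (‖w - z‖ * ‖g w‖) := by
    filter_upwards [hfne, hfg.filter_mono nhdsWithin_le_nhds, hfh.filter_mono nhdsWithin_le_nhds,
      hB.filter_mono nhdsWithin_le_nhds, self_mem_nhdsWithin] with w h1 h2 h3 h4 h5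
    have hw : 0 < ‖w - z‖ := by simpa [sub_eq_zero] using h5
    rw [norm_div, div_le_iff₀ (by simpa using h1), h2, h3] at h4
    simp only [smul_eq_mul, norm_mul, norm_pow, pow_succ] at h4
    have : ‖w - z‖ ^ n * ‖h w‖ ≤ ‖w - z‖ ^ n * (B * (‖w - z‖ * ‖g w‖)) := by
      linarith [h4]
    exact le_of_mul_le_mul_left this (by positivity)
  have hlim1 : Tendsto (fun w => ‖h w‖) (nhdsWithin z {z}ᶜ) (nhds ‖h z‖) :=
    hh.continuousAt.norm.tendsto.mono_left nhdsWithin_le_nhds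
  have hlim2 : Tendsto (fun w => B * (‖w - z‖ * ‖g w‖)) (nhdsWithin z {z}ᶜ) (nhds 0) := by
    have : ContinuousAt (fun w => B * (‖w - z‖ * ‖g w‖)) z := by
      have := hg.continuousAt
      fun_prop
    simpa using this.tendsto.mono_left (nhdsWithin_le_nhds (s := {z}ᶜ))
  have := le_of_tendsto_of_tendsto hlim1 hlim2 hle
  exact hh0 (norm_le_zero_iff.1 this)

lemma exists_norm_one_add_pow_sub_le (n : ℕ) {D : ℝ} :
    ∃ C : ℝ, 0 ≤ C ∧ ∀ z : ℂ, ‖z‖ ≤ D → ‖(1 + z) ^ n - 1 - n * z‖ ≤ C * ‖z‖ ^ 2 := by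
  induction n with
  | zero => exact ⟨0, le_rfl, fun z _ => by simp⟩
  | succ n ih =>
    obtain ⟨C, hC, h⟩ := ih
    refine ⟨(1 + |D|) * C + n, by positivity, fun z hz => ?_⟩
    have : (1 + z) ^ (n + 1) - 1 - ((n + 1 : ℕ) : ℂ) * z =
        (1 + z) * ((1 + z) ^ n - 1 - n * z) + n * z ^ 2 := by push_cast; ring
    rw [this]
    refine (norm_add_le _ _).trans ?_
    rw [norm_mul, norm_mul, norm_pow, Complex.norm_natCast, add_mul]
    have h1 : ‖1 + z‖ ≤ 1 + |D| := by
      refine (norm_add_le _ _).trans ?_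
      rw [norm_one]
      linarith [le_abs_self D]
    rw [mul_assoc]
    gcongr
    exact h z hz

/-- `f` grows at most like `exp (A * |s| ^ α)` on `U`. -/
def HasGrowthOn (f : ℂ → ℂ) (U : Set ℂ) (α : ℝ) : Prop :=
  ∃ A : ℝ, 0 ≤ A ∧ ∀ s ∈ U, ‖f s‖ ≤ Real.exp (A * (1 + ‖s‖) ^ α)

/-- `f` grows at most polynomially on `U`. -/
def PolyBoundedOn (f : ℂ → ℂ) (U : Set ℂ) : Prop :=
  ∃ (A : ℝ) (k : ℕ), 0 ≤ A ∧ ∀ s ∈ U, ‖f s‖ ≤ A * (1 + ‖s‖) ^ k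

section Growth

variable {f g : ℂ → ℂ} {U V : Set ℂ} {α β : ℝ}

lemma HasGrowthOn.mono (h : HasGrowthOn f U α) (hV : V ⊆ U) : HasGrowthOn f V α := by
  obtain ⟨A, hA, h⟩ := h
  exact ⟨A, hA, fun s hs => h s (hV hs)⟩

lemma HasGrowthOn.congr (h : HasGrowthOn f U α) (hfg : ∀ s ∈ U, g s = f s) :
    HasGrowthOn g U α := by
  obtain ⟨A, hA, h⟩ := h
  exact ⟨A, hA, fun s hs => by rw [hfg s hs]; exact h s hs⟩

lemma HasGrowthOn.mono_exponent (h : HasGrowthOn f U α) (hαβ : α ≤ β) : HasGrowthOn f U β := by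
  obtain ⟨A, hA, h⟩ := h
  refine ⟨A, hA, fun s hs => (h s hs).trans ?_⟩
  gcongr
  linarith [norm_nonneg s]

lemma HasGrowthOn.mul (hf : HasGrowthOn f U α) (hg : HasGrowthOn g U α) :
    HasGrowthOn (fun s => f s * g s) U α := by
  obtain ⟨A, hA, hf⟩ := hf
  obtain ⟨B, hB, hg⟩ := hg
  refine ⟨A + B, by positivity, fun s hs => ?_⟩
  rw [norm_mul, add_mul, Real.exp_add]
  exact mul_le_mul (hf s hs) (hg s hs) (norm_nonneg _) (Real.exp_nonneg _)

lemma HasGrowthOn.prod {ι : Type*} {t : Finset ι} {f : ι → ℂ → ℂ}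
    (h : ∀ i ∈ t, HasGrowthOn (f i) U α) : HasGrowthOn (fun s => ∏ i ∈ t, f i s) U α := by
  classical
  induction t using Finset.induction_on with
  | empty => exact ⟨0, le_rfl, fun s _ => by simp⟩
  | insert i t hi ih =>
    simp only [Finset.prod_insert hi]
    exact (h i (by simp)).mul (ih fun j hj => h j (by simp [hj]))

lemma HasGrowthOn.union (hU : HasGrowthOn f U α) (hV : HasGrowthOn f V α) :
    HasGrowthOn f (U ∪ V) α := by
  obtain ⟨A, hA, hU⟩ := hU
  obtain ⟨B, hB, hV⟩ := hV
  refine ⟨max A B, le_max_of_le_left hA, fun s hs => ?_⟩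
  rcases hs with hs | hs
  · refine (hU s hs).trans ?_
    gcongr
    exact le_max_left _ _
  · refine (hV s hs).trans ?_
    gcongr
    exact le_max_right _ _

lemma HasGrowthOn.of_norm_le_comp {φ : ℂ → ℂ} {c : ℝ} (h : HasGrowthOn f U α) (hα : 0 ≤ α)
    (hc : 0 ≤ c) (hφ : ∀ s ∈ V, φ s ∈ U ∧ ‖φ s‖ ≤ ‖s‖ + c ∧ ‖g s‖ ≤ ‖f (φ s)‖) :
    HasGrowthOn g V α := by
  obtain ⟨A, hA, h⟩ := h
  refine ⟨A * (1 + c) ^ α, by positivity, fun s hs => ?_⟩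
  obtain ⟨h1, h2, h3⟩ := hφ s hs
  refine (h3.trans (h _ h1)).trans (Real.exp_le_exp.2 ?_)
  rw [mul_assoc, ← Real.mul_rpow (by positivity) (by positivity)]
  have : 1 + ‖φ s‖ ≤ (1 + c) * (1 + ‖s‖) := by nlinarith [norm_nonneg s]
  gcongr

lemma PolyBoundedOn.of_norm_le_comp {φ : ℂ → ℂ} {c : ℝ} (h : PolyBoundedOn f U)
    (hc : 0 ≤ c) (hφ : ∀ s ∈ V, φ s ∈ U ∧ ‖φ s‖ ≤ ‖s‖ + c ∧ ‖g s‖ ≤ ‖f (φ s)‖) :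
    PolyBoundedOn g V := by
  obtain ⟨A, k, hA, h⟩ := h
  refine ⟨A * (1 + c) ^ k, k, by positivity, fun s hs => ?_⟩
  obtain ⟨h1, h2, h3⟩ := hφ s hs
  refine (h3.trans (h _ h1)).trans ?_
  rw [mul_assoc, ← mul_pow]
  have : 1 + ‖φ s‖ ≤ (1 + c) * (1 + ‖s‖) := by nlinarith [norm_nonneg s]
  gcongr

lemma PolyBoundedOn.congr (h : PolyBoundedOn f U) (hfg : ∀ s ∈ U, g s = f s) :
    PolyBoundedOn g U := by
  obtain ⟨A, k, hA, h⟩ := h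
  exact ⟨A, k, hA, fun s hs => by rw [hfg s hs]; exact h s hs⟩

lemma PolyBoundedOn.of_norm_le {C : ℝ} (h : ∀ s ∈ U, ‖f s‖ ≤ C) : PolyBoundedOn f U :=
  ⟨|C|, 0, abs_nonneg C, fun s hs => by simpa using (h s hs).trans (le_abs_self C)⟩

lemma PolyBoundedOn.mul (hf : PolyBoundedOn f U) (hg : PolyBoundedOn g U) :
    PolyBoundedOn (fun s => f s * g s) U := by
  obtain ⟨A, k, hA, hf⟩ := hf
  obtain ⟨B, l, hB, hg⟩ := hg
  refine ⟨A * B, k + l, by positivity, fun s hs => ?_⟩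
  rw [norm_mul, pow_add, mul_mul_mul_comm]
  exact mul_le_mul (hf s hs) (hg s hs) (norm_nonneg _) (by positivity)

lemma PolyBoundedOn.pow (hf : PolyBoundedOn f U) (n : ℕ) :
    PolyBoundedOn (fun s => f s ^ n) U := by
  obtain ⟨A, k, hA, hf⟩ := hf
  refine ⟨A ^ n, k * n, by positivity, fun s hs => ?_⟩
  rw [norm_pow, pow_mul, ← mul_pow]
  exact pow_le_pow_left₀ (norm_nonneg _) (hf s hs) n

lemma PolyBoundedOn.prod {ι : Type*} {t : Finset ι} {f : ι → ℂ → ℂ}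
    (h : ∀ i ∈ t, PolyBoundedOn (f i) U) : PolyBoundedOn (fun s => ∏ i ∈ t, f i s) U := by
  classical
  induction t using Finset.induction_on with
  | empty => exact ⟨1, 0, zero_le_one, fun s _ => by simp⟩
  | insert i t hi ih =>
    simp only [Finset.prod_insert hi]
    exact (h i (by simp)).mul (ih fun j hj => h j (by simp [hj]))

lemma PolyBoundedOn.sub_const (c : ℂ) : PolyBoundedOn (fun s => s - c) U :=
  ⟨1 + ‖c‖, 1, by positivity, fun s _ => (norm_sub_le _ _).trans (by
    nlinarith [norm_nonneg s, norm_nonneg c, mul_nonneg (norm_nonneg s) (norm_nonneg c)])⟩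

lemma PolyBoundedOn.const_sub (c : ℂ) : PolyBoundedOn (fun s => c - s) U := by
  obtain ⟨A, k, hA, h⟩ := PolyBoundedOn.sub_const (U := U) c
  exact ⟨A, k, hA, fun s hs => by rw [norm_sub_rev]; exact h s hs⟩

lemma PolyBoundedOn.hasGrowthOn (hf : PolyBoundedOn f U) (hα : 1 ≤ α) : HasGrowthOn f U α := by
  obtain ⟨A, k, hA, hf⟩ := hf
  refine ⟨A + k, by positivity, fun s hs => (hf s hs).trans ?_⟩
  have h1 : 1 ≤ 1 + ‖s‖ := by linarith [norm_nonneg s]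
  have h2 : 1 + ‖s‖ ≤ (1 + ‖s‖) ^ α := Real.self_le_rpow_of_one_le h1 hα
  rw [add_mul, Real.exp_add]
  gcongr
  · calc A ≤ Real.exp A := by linarith [Real.add_one_le_exp A]
      _ ≤ _ := by gcongr; exact le_mul_of_one_le_right hA (h1.trans h2)
  · rw [Real.exp_nat_mul]
    gcongr
    linarith [Real.add_one_le_exp ((1 + ‖s‖) ^ α)]

/-- The Phragmén–Lindelöf principle in a vertical strip for polynomial bounds. -/
lemma PolyBoundedOn.of_vertical_strip (hf : Differentiable ℂ f) {a b T : ℝ} (hab : a < b)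
    (ha : PolyBoundedOn f {s | s.re = a}) (hb : PolyBoundedOn f {s | s.re = b})
    (hgr : HasGrowthOn f {s | (a ≤ s.re ∧ s.re ≤ b) ∧ T ≤ |s.im|} α) (hα : 0 ≤ α) :
    PolyBoundedOn f {s | a ≤ s.re ∧ s.re ≤ b} := by
  obtain ⟨A, k, hA, ha⟩ := ha
  obtain ⟨B, l, hB, hb⟩ := hb
  obtain ⟨D, hD, hgr⟩ := hgr
  set K : ℂ := ((b + 1 : ℝ) : ℂ) with hK
  set m := k + l with hm
  have hK1 : ∀ s : ℂ, s.re ≤ b → 1 ≤ ‖s - K‖ := by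
    intro s hs
    refine le_trans ?_ (Complex.abs_re_le_norm (s - K))
    rw [hK, Complex.sub_re, Complex.ofReal_re, le_abs]
    right; linarith
  have hK2 : ∀ s : ℂ, s.re ≤ b → 1 + ‖s‖ ≤ (2 + ‖K‖) * ‖s - K‖ := by
    intro s hs
    have h1 := hK1 s hs
    have h2 : ‖s‖ ≤ ‖s - K‖ + ‖K‖ := by simpa using norm_add_le (s - K) K
    nlinarith [norm_nonneg K]
  have hpos : ∀ s : ℂ, 1 ≤ 1 + ‖s‖ := fun s => by linarith [norm_nonneg s]
  have edge : ∀ (E : ℝ) (j : ℕ), 0 ≤ E → j ≤ m → E ≤ A + B → ∀ s : ℂ, s.re ≤ b →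
      ‖f s‖ ≤ E * (1 + ‖s‖) ^ j → ‖f s / (s - K) ^ m‖ ≤ (A + B) * (2 + ‖K‖) ^ m := by
    intro E j hE hj hEAB s hs hfs
    have h1 := hK1 s hs
    rw [norm_div, norm_pow, div_le_iff₀ (by positivity), mul_assoc, ← mul_pow]
    refine hfs.trans ?_
    gcongr ?_ * ?_
    exact (pow_le_pow_right₀ (hpos s) hj).trans
      (pow_le_pow_left₀ (by positivity) (hK2 s hs) m)
  have key : ∀ s : ℂ, a ≤ s.re → s.re ≤ b →
      ‖f s / (s - K) ^ m‖ ≤ (A + B) * (2 + ‖K‖) ^ m := by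
    intro s hsa hsb
    refine PhragmenLindelof.vertical_strip (f := fun s => f s / (s - K) ^ m) (a := a) (b := b)
      ?_ ?_ ?_ ?_ hsa hsb
    · refine DifferentiableOn.diffContOnCl fun z hz => ?_
      have hz' : z.re ≤ b := by
        have : closure (Complex.re ⁻¹' Set.Ioo a b) ⊆ {z : ℂ | z.re ≤ b} :=
          closure_minimal (fun w hw => hw.2.le)
            (isClosed_le Complex.continuous_re continuous_const)
        exact this hz
      have hne : (z - K) ^ m ≠ 0 := by
        refine pow_ne_zero _ (norm_pos_iff.1 ?_)
        linarith [hK1 z hz']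
      exact ((hf z).div (by fun_prop) hne).differentiableWithinAt
    · have hba : 0 < b - a := by linarith
      have hc : 0 < Real.pi / (b - a) / 2 := by positivity
      refine ⟨Real.pi / (b - a) / 2, by linarith, ?_⟩
      set c := Real.pi / (b - a) / 2
      set R : ℝ := 1 + (|a| + |b|) with hR
      refine ⟨Real.exp (c * R), ?_⟩
      have hlit := (isLittleO_rpow_exp_pos_mul_atTop α hc).bound
        (show (0 : ℝ) < 1 / (D + 1) by positivity)
      have hlit2 : ∀ᶠ y : ℝ in atTop,
          D * (R + y) ^ α ≤ Real.exp (c * R) * Real.exp (c * y) := by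
        filter_upwards [(tendsto_atTop_add_const_left atTop R tendsto_id).eventually hlit,
          eventually_ge_atTop 0] with y hy hy0
        simp only [id] at hy
        have hRy : 0 ≤ (R + y) ^ α := by positivity
        rw [Real.norm_of_nonneg hRy, Real.norm_of_nonneg (Real.exp_nonneg _), one_div,
          inv_mul_eq_div, le_div_iff₀ (by positivity)] at hy
        rw [← Real.exp_add, ← mul_add]
        nlinarith
      refine Asymptotics.IsBigO.of_bound 1 ?_
      have h1 : ∀ᶠ z : ℂ in comap (_root_.abs ∘ Complex.im) atTop,
          T ≤ |z.im| ∧ D * (R + |z.im|) ^ α ≤ Real.exp (c * R) * Real.exp (c * |z.im|) :=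
        ((eventually_ge_atTop T).and hlit2).comap (_root_.abs ∘ Complex.im)
      filter_upwards [h1.filter_mono inf_le_left,
        mem_inf_of_right (mem_principal_self _)] with z hz hzs
      obtain ⟨hza, hzb⟩ : a < z.re ∧ z.re < b := hzs
      have h2 := hK1 z hzb.le
      rw [norm_div, norm_pow, one_mul, Real.norm_of_nonneg (Real.exp_nonneg _)]
      calc ‖f z‖ / ‖z - K‖ ^ m ≤ ‖f z‖ := div_le_self (norm_nonneg _) (one_le_pow₀ h2)
        _ ≤ Real.exp (D * (1 + ‖z‖) ^ α) := hgr z ⟨⟨hza.le, hzb.le⟩, hz.1⟩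
        _ ≤ Real.exp (D * (R + |z.im|) ^ α) := by
          refine Real.exp_le_exp.2 ?_
          have : ‖z‖ ≤ |z.re| + |z.im| := Complex.norm_le_abs_re_add_abs_im z
          have : |z.re| ≤ |a| + |b| := by
            rw [abs_le]
            constructor <;>
              linarith [neg_abs_le a, le_abs_self b, abs_nonneg a, abs_nonneg b]
          have : 1 + ‖z‖ ≤ R + |z.im| := by linarith
          gcongr
        _ ≤ _ := Real.exp_le_exp.2 hz.2
    · intro z hz
      exact edge A k hA (by omega) (by linarith) z (by linarith) (ha z hz)
    · intro z hz
      exact edge B l hB (by omega) (by linarith) z hz.le (hb z hz)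
  refine ⟨(A + B) * (2 + ‖K‖) ^ m * (1 + ‖K‖) ^ m, m, by positivity, fun s hs => ?_⟩
  have h1 := key s hs.1 hs.2
  have h2 := hK1 s hs.2
  rw [norm_div, norm_pow, div_le_iff₀ (by positivity)] at h1
  refine h1.trans ?_
  rw [mul_assoc _ ((1 + ‖K‖) ^ m), ← mul_pow]
  gcongr
  refine (norm_sub_le _ _).trans ?_
  nlinarith [norm_nonneg s, norm_nonneg K, mul_nonneg (norm_nonneg s) (norm_nonneg K)]

end Growth

section GammaBounds

lemma norm_Gamma_le_Gamma_re {z : ℂ} (hz : 0 < z.re) : ‖Complex.Gamma z‖ ≤ Real.Gamma z.re := by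
  rw [Complex.Gamma_eq_integral hz, Real.Gamma_eq_integral hz, Complex.GammaIntegral]
  refine (norm_integral_le_integral_norm _).trans (le_of_eq ?_)
  refine setIntegral_congr_fun measurableSet_Ioi fun x hx => ?_
  have hx' : 0 < x := hx
  simp only [norm_mul, Complex.norm_real, Real.norm_of_nonneg (Real.exp_nonneg _)]
  rw [Complex.norm_cpow_eq_rpow_re_of_pos hx']
  simp

lemma Gamma_le_exp_rpow {x : ℝ} (hx : 2 ≤ x) :
    Real.Gamma x ≤ Real.exp (2 * (1 + x) ^ (3 / 2 : ℝ)) := by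
  have hc1 : x ≤ ⌈x⌉₊ := Nat.le_ceil x
  have hc2 : (⌈x⌉₊ : ℝ) ≤ 1 + x := by linarith [Nat.ceil_lt_add_one (by linarith : 0 ≤ x)]
  have hpos : 0 < 1 + x := by linarith
  calc Real.Gamma x ≤ Real.Gamma (⌈x⌉₊ + 1) :=
        Real.Gamma_strictMonoOn_Ici.monotoneOn hx (by simp; linarith) (by linarith)
    _ = (Nat.factorial ⌈x⌉₊ : ℝ) := Real.Gamma_nat_eq_factorial _
    _ ≤ (⌈x⌉₊ : ℝ) ^ ⌈x⌉₊ := by exact_mod_cast Nat.factorial_le_pow _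
    _ ≤ (1 + x) ^ ⌈x⌉₊ := by gcongr
    _ = (1 + x) ^ (⌈x⌉₊ : ℝ) := (Real.rpow_natCast _ _).symm
    _ ≤ (1 + x) ^ (1 + x) := by
        gcongr
        linarith
    _ = Real.exp (Real.log (1 + x) * (1 + x)) := Real.rpow_def_of_pos hpos _
    _ ≤ Real.exp (2 * (1 + x) ^ (3 / 2 : ℝ)) := by
        refine Real.exp_le_exp.2 ?_
        have h1 := Real.log_le_rpow_div hpos.le (show (0 : ℝ) < 1 / 2 by norm_num)
        have h2 : (1 + x) ^ (3 / 2 : ℝ) = (1 + x) ^ (1 / 2 : ℝ) * (1 + x) := by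
          rw [← Real.rpow_add_one hpos.ne']
          norm_num
        rw [h2, ← mul_assoc]
        gcongr
        linarith

lemma exists_norm_Gamma_le_of_one_le_abs_im (a b : ℝ) :
    ∃ C : ℝ, ∀ z : ℂ, a ≤ z.re → z.re ≤ b → 1 ≤ |z.im| → ‖Complex.Gamma z‖ ≤ C := by
  obtain ⟨k, hk⟩ := exists_nat_ge (2 - a)
  induction k generalizing a b with
  | zero =>
    refine ⟨Real.Gamma b, fun z hza hzb _ => ?_⟩
    have h2 : 2 ≤ z.re := by simp at hk; linarith
    exact (norm_Gamma_le_Gamma_re (by linarith)).trans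
      (Real.Gamma_strictMonoOn_Ici.monotoneOn h2 (h2.trans hzb) hzb)
  | succ k ih =>
    obtain ⟨C, hC⟩ := ih (a + 1) (b + 1) (by push_cast at hk; linarith)
    refine ⟨C, fun z hza hzb him => ?_⟩
    have hz1 : 1 ≤ ‖z‖ := him.trans (Complex.abs_im_le_norm z)
    have h := hC (z + 1) (by simpa using hza) (by simpa using hzb) (by simpa using him)
    rw [Complex.Gamma_add_one z (norm_pos_iff.1 (by linarith)), norm_mul] at h
    exact (le_mul_of_one_le_left (norm_nonneg _) hz1).trans h

end GammaBounds

/-- A Dirichlet series converging absolutely at `t` is bounded on the half-plane to the right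
of `t`. -/
lemma norm_le_tsum_of_hasSum_dirichlet {b : ℕ → ℂ} {j : ℕ} (hj : 0 < j) {s t v : ℂ}
    (hst : t.re ≤ s.re)
    (hsum : HasSum (fun n : ℕ => b (n + j) * ((n + j : ℕ) : ℂ) ^ (-s)) v)
    (habs : Summable (fun n : ℕ => ‖b (n + j) * ((n + j : ℕ) : ℂ) ^ (-t)‖)) :
    ‖v‖ ≤ ∑' n : ℕ, ‖b (n + j) * ((n + j : ℕ) : ℂ) ^ (-t)‖ := by
  rw [← hsum.tsum_eq]
  refine tsum_of_norm_bounded habs.hasSum fun n => ?_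
  have hpos : 0 < n + j := by omega
  rw [norm_mul, norm_mul, Complex.norm_natCast_cpow_of_pos hpos,
    Complex.norm_natCast_cpow_of_pos hpos]
  gcongr ?_ * ?_
  refine Real.rpow_le_rpow_of_exponent_le ?_ (by simpa using hst)
  exact_mod_cast hpos

lemma hasGrowthOn_ofReal_cpow {Q : ℝ} (hQ : 0 < Q) (U : Set ℂ) :
    HasGrowthOn (fun s => (Q : ℂ) ^ s) U 1 := by
  refine ⟨|Real.log Q|, abs_nonneg _, fun s _ => ?_⟩
  rw [Complex.norm_cpow_eq_rpow_re_of_pos hQ, Real.rpow_def_of_pos hQ, Real.rpow_one]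
  refine Real.exp_le_exp.2 ((le_abs_self _).trans ?_)
  rw [abs_mul]
  gcongr
  linarith [Complex.abs_re_le_norm s]

lemma hasGrowthOn_Gamma {l C : ℝ} {μ : ℂ} (hl : 0 < l) (hC : 2 ≤ l * C + μ.re) :
    HasGrowthOn (fun s => Complex.Gamma (l * s + μ)) {s | C ≤ s.re} (3 / 2) := by
  refine ⟨2 * (1 + l + ‖μ‖) ^ (3 / 2 : ℝ), by positivity, fun s hs => ?_⟩
  have hs' : C ≤ s.re := hs
  have hre : ((l : ℂ) * s + μ).re = l * s.re + μ.re := by simp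
  have h2 : 2 ≤ ((l : ℂ) * s + μ).re := by
    rw [hre]
    nlinarith
  refine ((norm_Gamma_le_Gamma_re (by linarith)).trans (Gamma_le_exp_rpow h2)).trans
    (Real.exp_le_exp.2 ?_)
  rw [mul_assoc, ← Real.mul_rpow (by positivity) (by positivity), hre]
  have h3 : 1 + (l * s.re + μ.re) ≤ (1 + l + ‖μ‖) * (1 + ‖s‖) := by
    have h4 := Complex.re_le_norm s
    have h5 := Complex.re_le_norm μ
    have h6 : l * s.re ≤ l * ‖s‖ := by gcongr
    nlinarith [norm_nonneg s, norm_nonneg μ, mul_nonneg (norm_nonneg s) (norm_nonneg μ)]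
  have h7 : 0 ≤ 1 + (l * s.re + μ.re) := by rw [← hre]; linarith
  gcongr

namespace SSF

variable {σ0 σ1 : ℝ} (S : SSF σ0 σ1)

/-- The polynomial factor `∏ (σ₁ - s - conj sᵢ) ^ mᵢ` over the unpaired poles. -/
def reflFactor (s : ℂ) : ℂ :=
  ∏ i : Fin S.N, (if 2 * S.M + S.dlt ≤ (i : ℕ) then
    ((σ1 : ℂ) - s - (starRingEnd ℂ) (S.pole i)) ^ S.m i else 1)

/-- The half-plane `Re s ≥ C` lies to the right of all the exceptional points of the completed
product. -/
structure IsRightAbscissa (C : ℝ) : Prop where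
  lt : σ0 < C
  pole_re_lt : ∀ i, (S.pole i).re < C
  refl_pole_re_lt : ∀ i, σ1 - (S.pole i).re < C
  two_le : ∀ j, 2 ≤ S.lam j * C + (S.mu j).re

lemma exists_isRightAbscissa : ∃ C, S.IsRightAbscissa C := by
  have h1 : ∀ᶠ C : ℝ in atTop, ∀ i, (S.pole i).re < C :=
    eventually_all.2 fun i => eventually_gt_atTop _
  have h2 : ∀ᶠ C : ℝ in atTop, ∀ i, σ1 - (S.pole i).re < C :=
    eventually_all.2 fun i => eventually_gt_atTop _
  have h3 : ∀ᶠ C : ℝ in atTop, ∀ j, 2 ≤ S.lam j * C + (S.mu j).re :=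
    eventually_all.2 fun j => (tendsto_atTop_add_const_right _ _
      (tendsto_id.const_mul_atTop (S.hlam j))).eventually_ge_atTop 2
  obtain ⟨C, hC0, hC1, hC2, hC3⟩ :=
    ((eventually_gt_atTop σ0).and (h1.and (h2.and h3))).exists
  exact ⟨C, hC0, hC1, hC2, hC3⟩

lemma polyBoundedOn_reflFactor (U : Set ℂ) : PolyBoundedOn S.reflFactor U := by
  refine PolyBoundedOn.prod fun i _ => ?_
  by_cases hi : 2 * S.M + S.dlt ≤ (i : ℕ)
  · simp only [hi, if_true]
    refine PolyBoundedOn.pow ?_ _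
    refine (PolyBoundedOn.const_sub ((σ1 : ℂ) - (starRingEnd ℂ) (S.pole i))).congr fun s _ => ?_
    ring
  · simp only [hi, if_false]
    exact PolyBoundedOn.of_norm_le (C := 1) fun s _ => by simp

lemma polyBoundedOn_poleFactor (U : Set ℂ) :
    PolyBoundedOn (fun s => ∏ i, (s - S.pole i) ^ S.m i) U :=
  PolyBoundedOn.prod fun _ _ => (PolyBoundedOn.sub_const _).pow _

lemma norm_xi_eq (s : ℂ) : ‖S.xi s‖ = ‖S.xi ((σ1 : ℂ) - (starRingEnd ℂ) s)‖ := by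
  rw [S.hFE s, norm_mul, S.hω, one_mul, Complex.norm_conj]

lemma norm_refl_le (h : 0 ≤ σ1) (s : ℂ) : ‖(σ1 : ℂ) - (starRingEnd ℂ) s‖ ≤ ‖s‖ + σ1 := by
  refine (norm_sub_le _ _).trans ?_
  rw [Complex.norm_conj, Complex.norm_real, Real.norm_of_nonneg h, add_comm]

variable {S} {C : ℝ}

namespace IsRightAbscissa

lemma ne_pole (hC : S.IsRightAbscissa C) {s : ℂ} (hs : C ≤ s.re) (i : Fin S.N) :
    s ≠ S.pole i := by
  rintro rfl
  linarith [hC.pole_re_lt i]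

lemma two_le_re (hC : S.IsRightAbscissa C) {s : ℂ} (hs : C ≤ s.re) (j : Fin S.r) :
    2 ≤ ((S.lam j : ℂ) * s + S.mu j).re := by
  have := mul_le_mul_of_nonneg_left hs (S.hlam j).le
  have := hC.two_le j
  simp
  linarith

lemma xi_eq (hC : S.IsRightAbscissa C) {s : ℂ} (hs : C ≤ s.re) :
    S.xi s = S.F s * (S.Q : ℂ) ^ s * (∏ j, Complex.Gamma ((S.lam j : ℂ) * s + S.mu j)) *
      (∏ i, (s - S.pole i) ^ S.m i) * S.reflFactor s := by
  refine S.hxiEq s (hC.ne_pole hs) fun j k h => ?_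
  have h2 := hC.two_le_re hs j
  rw [h] at h2
  simp at h2
  linarith [(Nat.cast_nonneg k : (0 : ℝ) ≤ k)]

lemma exists_norm_F_le (hC : S.IsRightAbscissa C) :
    ∃ B, ∀ s : ℂ, C ≤ s.re → ‖S.F s‖ ≤ B :=
  ⟨_, fun s hs => norm_le_tsum_of_hasSum_dirichlet (t := (C : ℂ)) one_pos (by simpa using hs)
    (S.hDir s (hC.lt.trans_le hs)) (S.hDirAbs C (by simpa using hC.lt))⟩

lemma exists_norm_logDeriv_le (hC : S.IsRightAbscissa C) :
    ∃ B, ∀ s : ℂ, C ≤ s.re → ‖deriv S.F s / S.F s‖ ≤ B :=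
  ⟨_, fun s hs => by
    rw [← norm_neg]
    exact norm_le_tsum_of_hasSum_dirichlet (t := (C : ℂ)) two_pos (by simpa using hs)
      (S.hEuler s (hC.lt.trans_le hs)) (S.hEulerAbs C (by simpa using hC.lt))⟩

lemma xi_ne_zero (hC : S.IsRightAbscissa C) (h0 : S.xi 0 ≠ 0) {s : ℂ} (hs : C < s.re) :
    S.xi s ≠ 0 := by
  have hU : ∀ᶠ w in nhds s, C ≤ w.re :=
    (Complex.continuous_re.continuousAt.eventually (lt_mem_nhds hs)).mono fun w hw => le_of_lt hw
  have hFan : AnalyticAt ℂ S.F s := by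
    have h1 : AnalyticAt ℂ (fun w => S.G w / ∏ i, (w - S.pole i) ^ S.m i) s := by
      refine (S.hGdiff.analyticAt s).div ?_ ?_
      · exact Differentiable.analyticAt (by fun_prop) s
      · exact Finset.prod_ne_zero_iff.2 fun i _ =>
          pow_ne_zero _ (sub_ne_zero.2 (hC.ne_pole hs.le i))
    refine h1.congr ?_
    filter_upwards [hU] with w hw
    rw [S.hGF w (hC.ne_pole hw), mul_div_cancel_left₀]
    exact Finset.prod_ne_zero_iff.2 fun i _ =>
      pow_ne_zero _ (sub_ne_zero.2 (hC.ne_pole hw i))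
  obtain ⟨B, hB⟩ := hC.exists_norm_logDeriv_le
  have hF : S.F s ≠ 0 := by
    refine ne_zero_of_norm_deriv_div_le hFan (fun hzero => ?_) (hU.mono hB)
    have hxi : S.xi =ᶠ[nhds s] 0 := by
      filter_upwards [hzero, hU] with w hw hwU
      rw [hC.xi_eq hwU, hw]
      simp
    have han : AnalyticOnNhd ℂ S.xi Set.univ := fun z _ => S.hxiDiff.analyticAt z
    exact h0 (han.eqOn_zero_of_preconnected_of_eventuallyEq_zero isPreconnected_univ
      (Set.mem_univ s) hxi (Set.mem_univ 0))
  rw [hC.xi_eq hs.le, reflFactor]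
  refine mul_ne_zero (mul_ne_zero (mul_ne_zero (mul_ne_zero hF ?_) ?_) ?_) ?_
  · simp [Complex.cpow_eq_zero_iff, S.hQ.ne']
  · exact Finset.prod_ne_zero_iff.2 fun j _ =>
      Complex.Gamma_ne_zero_of_re_pos (by linarith [hC.two_le_re hs.le j])
  · exact Finset.prod_ne_zero_iff.2 fun i _ =>
      pow_ne_zero _ (sub_ne_zero.2 (hC.ne_pole hs.le i))
  · refine Finset.prod_ne_zero_iff.2 fun i _ => ?_
    split_ifs
    · refine pow_ne_zero _ fun h => ?_
      have h' := congrArg Complex.re h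
      simp at h'
      linarith [hC.refl_pole_re_lt i]
    · exact one_ne_zero

lemma re_mem_Icc_of_xi_eq_zero (hC : S.IsRightAbscissa C) (h0 : S.xi 0 ≠ 0) {ρ : ℂ}
    (hρ : S.xi ρ = 0) : σ1 - C ≤ ρ.re ∧ ρ.re ≤ C := by
  constructor
  · by_contra! h
    refine hC.xi_ne_zero h0 (s := (σ1 : ℂ) - (starRingEnd ℂ) ρ) (by simp; linarith) ?_
    rw [← norm_eq_zero, ← S.norm_xi_eq, hρ, norm_zero]
  · by_contra! h
    exact hC.xi_ne_zero h0 h hρ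

lemma hasGrowthOn_xi_right (hC : S.IsRightAbscissa C) :
    HasGrowthOn S.xi {s | C ≤ s.re} (3 / 2) := by
  obtain ⟨B, hB⟩ := hC.exists_norm_F_le
  refine HasGrowthOn.congr ?_ fun s hs => hC.xi_eq hs
  refine (((HasGrowthOn.mul ?_ ?_).mul ?_).mul ?_).mul ?_
  · exact (PolyBoundedOn.of_norm_le hB).hasGrowthOn (by norm_num)
  · exact (hasGrowthOn_ofReal_cpow S.hQ _).mono_exponent (by norm_num)
  · exact HasGrowthOn.prod fun j _ => hasGrowthOn_Gamma (S.hlam j) (hC.two_le j)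
  · exact (S.polyBoundedOn_poleFactor _).hasGrowthOn (by norm_num)
  · exact (S.polyBoundedOn_reflFactor _).hasGrowthOn (by norm_num)

lemma polyBoundedOn_xi_line (hC : S.IsRightAbscissa C) :
    PolyBoundedOn S.xi {s | s.re = C} := by
  obtain ⟨B, hB⟩ := hC.exists_norm_F_le
  refine PolyBoundedOn.congr ?_ fun s hs => hC.xi_eq (le_of_eq (Eq.symm hs))
  refine (((PolyBoundedOn.mul ?_ ?_).mul ?_).mul ?_).mul ?_
  · exact PolyBoundedOn.of_norm_le fun s hs => hB s (le_of_eq (Eq.symm hs))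
  · refine PolyBoundedOn.of_norm_le (C := S.Q ^ C) fun s hs => ?_
    rw [Complex.norm_cpow_eq_rpow_re_of_pos S.hQ, show s.re = C from hs]
  · refine PolyBoundedOn.prod fun j _ =>
      PolyBoundedOn.of_norm_le (C := Real.Gamma (S.lam j * C + (S.mu j).re)) fun s hs => ?_
    have h2 := hC.two_le_re (le_of_eq (Eq.symm hs)) j
    refine (norm_Gamma_le_Gamma_re (by linarith)).trans (le_of_eq ?_)
    simp [show s.re = C from hs]
  · exact S.polyBoundedOn_poleFactor _
  · exact S.polyBoundedOn_reflFactor _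

end IsRightAbscissa

variable (S)

lemma exists_hasGrowthOn_G {T : ℝ} (hT : 1 ≤ T) :
    ∃ α, HasGrowthOn S.G {s | T ≤ |s.im|} α := by
  obtain ⟨c, B, h⟩ := S.hGord
  refine ⟨|B|, |c| + 1, by positivity, fun s hs => (h s).trans ?_⟩
  have hs1 : 1 ≤ ‖s‖ := (hT.trans hs).trans (Complex.abs_im_le_norm s)
  have h1 : ‖s‖ ^ B ≤ (1 + ‖s‖) ^ |B| :=
    (Real.rpow_le_rpow_of_exponent_le hs1 (le_abs_self B)).trans (by gcongr; linarith)
  have h2 : 1 ≤ (1 + ‖s‖) ^ |B| := Real.one_le_rpow (by linarith) (abs_nonneg B)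
  rw [add_mul, Real.exp_add, one_mul]
  refine mul_le_mul ?_ (Real.exp_le_exp.2 h1) (Real.exp_nonneg _) (Real.exp_nonneg _)
  calc c ≤ |c| := le_abs_self c
    _ ≤ |c| * (1 + ‖s‖) ^ |B| := le_mul_of_one_le_right (abs_nonneg _) h2
    _ ≤ _ := by linarith [Real.add_one_le_exp (|c| * (1 + ‖s‖) ^ |B|)]

lemma exists_hasGrowthOn_xi_strip (a b : ℝ) :
    ∃ T α : ℝ, 0 ≤ α ∧ HasGrowthOn S.xi {s | (a ≤ s.re ∧ s.re ≤ b) ∧ T ≤ |s.im|} α := by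
  have h1 : ∀ᶠ T : ℝ in atTop, ∀ i, |(S.pole i).im| < T :=
    eventually_all.2 fun i => eventually_gt_atTop _
  have h2 : ∀ᶠ T : ℝ in atTop, ∀ j, 1 ≤ S.lam j * T - |(S.mu j).im| :=
    eventually_all.2 fun j => (tendsto_atTop_add_const_right _ _
      (tendsto_id.const_mul_atTop (S.hlam j))).eventually_ge_atTop 1
  obtain ⟨T, hT, hpole, hmu⟩ := ((eventually_ge_atTop 1).and (h1.and h2)).exists
  obtain ⟨α, hG⟩ := S.exists_hasGrowthOn_G hT
  set U : Set ℂ := {s | (a ≤ s.re ∧ s.re ≤ b) ∧ T ≤ |s.im|}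
  have hα1 : (1 : ℝ) ≤ max α 1 := le_max_right _ _
  have hnp : ∀ s ∈ U, ∀ i, s ≠ S.pole i := by
    rintro s hs i rfl
    exact absurd hs.2 (not_le.2 (hpole i))
  have him : ∀ s ∈ U, ∀ j, 1 ≤ |((S.lam j : ℂ) * s + S.mu j).im| := by
    intro s hs j
    have h3 : ((S.lam j : ℂ) * s + S.mu j).im = S.lam j * s.im + (S.mu j).im := by simp
    have h4 : |S.lam j * s.im| = S.lam j * |s.im| := by rw [abs_mul, abs_of_pos (S.hlam j)]
    have h5 : S.lam j * T ≤ S.lam j * |s.im| := mul_le_mul_of_nonneg_left hs.2 (S.hlam j).le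
    have h6 : |S.lam j * s.im| ≤ |S.lam j * s.im + (S.mu j).im| + |(S.mu j).im| := by
      simpa using abs_add_le (S.lam j * s.im + (S.mu j).im) (-(S.mu j).im)
    rw [h3]
    linarith [hmu j]
  refine ⟨T, max α 1, by positivity, ?_⟩
  refine HasGrowthOn.congr (f := fun s => S.G s * (S.Q : ℂ) ^ s *
    (∏ j, Complex.Gamma ((S.lam j : ℂ) * s + S.mu j)) * S.reflFactor s) ?_ fun s hs => ?_
  · refine ((HasGrowthOn.mul ?_ ?_).mul ?_).mul ?_
    · exact (hG.mono fun s hs => hs.2).mono_exponent (le_max_left _ _)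
    · exact (hasGrowthOn_ofReal_cpow S.hQ _).mono_exponent hα1
    · refine HasGrowthOn.prod fun j _ => ?_
      obtain ⟨C, hC⟩ := exists_norm_Gamma_le_of_one_le_abs_im
        (S.lam j * a + (S.mu j).re) (S.lam j * b + (S.mu j).re)
      refine (PolyBoundedOn.of_norm_le (C := C) fun s hs => hC _ ?_ ?_ (him s hs j)).hasGrowthOn hα1
      · simpa using mul_le_mul_of_nonneg_left hs.1.1 (S.hlam j).le
      · simpa using mul_le_mul_of_nonneg_left hs.1.2 (S.hlam j).le
    · exact (S.polyBoundedOn_reflFactor _).hasGrowthOn hα1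
  · rw [S.hGF s (hnp s hs), S.hxiEq s (hnp s hs), reflFactor]
    · ring
    · intro j k h
      have h3 := him s hs j
      rw [h] at h3
      norm_num at h3

/-- The completed function has order at most `3 / 2`. -/
lemma hasGrowthOn_xi : HasGrowthOn S.xi Set.univ (3 / 2) := by
  obtain ⟨C, hC⟩ := S.exists_isRightAbscissa
  have hC0 : 0 < C := (S.hσ1pos.trans_le S.hσ).trans hC.lt
  have hC1 : σ1 < C := S.hσ.trans_lt hC.lt
  have hleft : HasGrowthOn S.xi {s | s.re ≤ σ1 - C} (3 / 2) :=
    hC.hasGrowthOn_xi_right.of_norm_le_comp (φ := fun s => (σ1 : ℂ) - (starRingEnd ℂ) s)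
      (by norm_num) S.hσ1pos.le fun s hs => by
        have hs' : s.re ≤ σ1 - C := hs
        exact ⟨by simp; linarith, norm_refl_le S.hσ1pos.le s, (S.norm_xi_eq s).le⟩
  have hline : PolyBoundedOn S.xi {s | s.re = σ1 - C} :=
    hC.polyBoundedOn_xi_line.of_norm_le_comp (φ := fun s => (σ1 : ℂ) - (starRingEnd ℂ) s)
      S.hσ1pos.le fun s hs => by
        have hs' : s.re = σ1 - C := hs
        exact ⟨by simp [hs'], norm_refl_le S.hσ1pos.le s, (S.norm_xi_eq s).le⟩
  obtain ⟨T, α, hα, hstrip⟩ := S.exists_hasGrowthOn_xi_strip (σ1 - C) C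
  have hmid := (PolyBoundedOn.of_vertical_strip S.hxiDiff (by linarith) hline
    hC.polyBoundedOn_xi_line hstrip hα).hasGrowthOn (α := 3 / 2) (by norm_num)
  refine ((hleft.union hmid).union hC.hasGrowthOn_xi_right).mono fun s _ => ?_
  rcases le_total s.re (σ1 - C) with h | h
  · exact Or.inl (Or.inl h)
  · rcases le_total s.re C with h' | h'
    · exact Or.inl (Or.inr ⟨h, h'⟩)
    · exact Or.inr h'

lemma summable_zeroOrder_xi_div (h0 : S.xi 0 ≠ 0) :
    Summable fun ρ : {ρ : ℂ // S.xi ρ = 0} =>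
      (zeroOrder S.xi ρ : ℝ) / (1 + ‖(ρ : ℂ)‖) ^ 2 := by
  obtain ⟨A, hA, h⟩ := S.hasGrowthOn_xi
  exact summable_zeroOrder_div S.hxiDiff h0 hA (by norm_num) (by norm_num)
    fun s => h s (Set.mem_univ s)

lemma finite_zeros_abs_im_le (h0 : S.xi 0 ≠ 0) (T : ℝ) :
    {ρ : ℂ | S.xi ρ = 0 ∧ |ρ.im| ≤ T}.Finite := by
  obtain ⟨C, hC⟩ := S.exists_isRightAbscissa
  have hcod : S.xi ⁻¹' {0}ᶜ ∈ codiscrete ℂ :=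
    AnalyticOnNhd.preimage_zero_mem_codiscrete (x := 0)
      (fun z _ => S.hxiDiff.analyticAt z) h0
  have hcpt : IsCompact (Set.Icc (σ1 - C) C ×ℂ Set.Icc (-T) T) :=
    isCompact_Icc.reProdIm isCompact_Icc
  refine (hcpt.finite_sdiff_of_mem_codiscreteWithin
    (codiscreteWithin_mono (Set.subset_univ _) hcod)).subset fun ρ hρ => ?_
  exact ⟨⟨hC.re_mem_Icc_of_xi_eq_zero h0 hρ.1, abs_le.1 hρ.2⟩, fun h => h hρ.1⟩

/-- The real parts of the terms of the `n`-th `τ`-Li coefficient decay quadratically. -/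
lemma exists_abs_re_liTerm_le {τ : ℝ} (hτ : 0 < τ) (h0 : S.xi 0 ≠ 0) (hτZ : S.xi (τ : ℂ) ≠ 0)
    (n : ℕ) : ∃ K : ℝ, ∀ ρ : ℂ, S.xi ρ = 0 →
      |(1 - (ρ / (ρ - τ)) ^ n).re| ≤ K / (1 + ‖ρ‖) ^ 2 := by
  obtain ⟨C, hC⟩ := S.exists_isRightAbscissa
  obtain ⟨δ, hδ, hball⟩ := Metric.eventually_nhds_iff.1
    (S.hxiDiff.continuous.continuousAt.eventually_ne hτZ)
  obtain ⟨B, hB, hpow⟩ := exists_norm_one_add_pow_sub_le n (D := τ / δ)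
  refine ⟨(n * (τ * (|σ1 - C| + |C| + τ)) + B * τ ^ 2) * ((1 + τ) / δ + 1) ^ 2, fun ρ hρ => ?_⟩
  set d : ℝ := ‖ρ - τ‖ with hd
  have hdδ : δ ≤ d := by
    by_contra! h
    exact hball (by rwa [dist_eq_norm]) hρ
  have hd0 : 0 < d := hδ.trans_le hdδ
  have hne : ρ - τ ≠ 0 := norm_pos_iff.1 hd0
  have hw : ‖(τ : ℂ) / (ρ - τ)‖ = τ / d := by
    rw [norm_div, Complex.norm_real, Real.norm_of_nonneg hτ.le]
  have hsplit : ρ / (ρ - τ) = 1 + (τ : ℂ) / (ρ - τ) := by field_simp; ring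
  have hremainder := hpow ((τ : ℂ) / (ρ - τ)) (by rw [hw]; gcongr)
  rw [hw, ← hsplit] at hremainder
  have hre : ((τ : ℂ) / (ρ - τ)).re = τ * (ρ.re - τ) / d ^ 2 := by
    rw [Complex.div_re, hd, Complex.sq_norm]
    simp
  have hreρ : |ρ.re - τ| ≤ |σ1 - C| + |C| + τ := by
    obtain ⟨h1, h2⟩ := hC.re_mem_Icc_of_xi_eq_zero h0 hρ
    rw [abs_le]
    constructor
    · linarith [neg_abs_le (σ1 - C), abs_nonneg C]
    · linarith [le_abs_self C, abs_nonneg (σ1 - C)]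
  have hnorm : 1 + ‖ρ‖ ≤ ((1 + τ) / δ + 1) * d := by
    have h1 : ‖ρ‖ ≤ d + τ := by
      simpa [abs_of_pos hτ] using norm_add_le (ρ - τ) (τ : ℂ)
    have h2 : 1 + τ ≤ (1 + τ) / δ * d := by
      rw [div_mul_eq_mul_div, le_div_iff₀ hδ]
      gcongr
    linarith
  have hmain : |(1 - (ρ / (ρ - τ)) ^ n).re| ≤
      (n * (τ * (|σ1 - C| + |C| + τ)) + B * τ ^ 2) / d ^ 2 := by
    have h1 : (1 - (ρ / (ρ - τ)) ^ n).re =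
        -(n * (τ * (ρ.re - τ) / d ^ 2)) -
          ((ρ / (ρ - τ)) ^ n - 1 - n * ((τ : ℂ) / (ρ - τ))).re := by
      rw [← hre, ← Complex.ofReal_natCast]
      simp only [Complex.sub_re, Complex.re_ofReal_mul, Complex.one_re]
      ring
    have h2 := (Complex.abs_re_le_norm _).trans hremainder
    have h3 : |n * (τ * (ρ.re - τ) / d ^ 2)| ≤ n * (τ * (|σ1 - C| + |C| + τ) / d ^ 2) := by
      rw [abs_mul, abs_div, abs_mul, Nat.abs_cast, abs_of_pos hτ, abs_of_pos (pow_pos hd0 2)]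
      gcongr
    calc _ ≤ n * (τ * (|σ1 - C| + |C| + τ) / d ^ 2) + B * (τ / d) ^ 2 := by
          rw [h1]
          refine (abs_sub _ _).trans ?_
          rw [abs_neg]
          exact add_le_add h3 h2
      _ = _ := by ring
  refine hmain.trans ?_
  rw [div_le_div_iff₀ (by positivity) (by positivity), mul_assoc, ← mul_pow]
  gcongr

end SSF

/-- For `F ∈ S^♯♭(σ₀,σ₁)`, `τ ≥ σ₁` with `0, τ ∉ Z(F)` and `n ≥ 1`, the
family `(ord(ρ)·Re(1 − (ρ/(ρ−τ))^n))_{ρ∈Z(F)}` is (absolutely) summable and the real part of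
the `τ`-Li coefficient `λ_F(n,τ)` equals its sum. -/
theorem re_tauLi_eq_abs_conv_sum (σ0 σ1 : ℝ) (S : SSF σ0 σ1) (τ : ℝ) (hτ : σ1 ≤ τ)
    (h0 : S.xi 0 ≠ 0) (hτZ : S.xi (τ : ℂ) ≠ 0) (n : ℕ) (hn : 0 < n) :
    Summable (fun ρ : {ρ : ℂ // S.xi ρ = 0} =>
        (zeroOrder S.xi ρ : ℝ) * (1 - ((ρ : ℂ) / ((ρ : ℂ) - τ)) ^ n).re) ∧
    ∀ L : ℂ, Filter.Tendsto (fun T : ℝ =>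
        ∑' ρ : {ρ : ℂ // S.xi ρ = 0 ∧ |ρ.im| ≤ T},
          (zeroOrder S.xi ρ : ℂ) * (1 - ((ρ : ℂ) / ((ρ : ℂ) - τ)) ^ n))
      Filter.atTop (nhds L) →
      L.re = ∑' ρ : {ρ : ℂ // S.xi ρ = 0},
        (zeroOrder S.xi ρ : ℝ) * (1 - ((ρ : ℂ) / ((ρ : ℂ) - τ)) ^ n).re := by
  have hsum : Summable (fun ρ : {ρ : ℂ // S.xi ρ = 0} =>
      (zeroOrder S.xi ρ : ℝ) * (1 - ((ρ : ℂ) / ((ρ : ℂ) - τ)) ^ n).re) := by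
    obtain ⟨K, hK⟩ := S.exists_abs_re_liTerm_le (S.hσ1pos.trans_le hτ) h0 hτZ n
    refine .of_norm_bounded ((S.summable_zeroOrder_xi_div h0).mul_left K) fun ρ => ?_
    rw [norm_mul, Real.norm_natCast, Real.norm_eq_abs, mul_div_left_comm]
    exact mul_le_mul_of_nonneg_left (hK ρ ρ.2) (Nat.cast_nonneg _)
  refine ⟨hsum, fun L hL => ?_⟩
  have hfin := S.finite_zeros_abs_im_le h0
  let Z : ℝ → Finset {ρ : ℂ // S.xi ρ = 0} := fun T =>
    ((hfin T).preimage (Subtype.val_injective.injOn)).toFinset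
  have hZ : Tendsto Z atTop atTop := by
    refine tendsto_atTop_finset_of_monotone (fun T T' h ρ => ?_) fun ρ => ⟨|(ρ : ℂ).im|, ?_⟩
    · simpa [Z, ρ.2] using fun h' => h'.trans h
    · simp [Z, ρ.2]
  refine tendsto_nhds_unique (((Complex.continuous_re.tendsto L).comp hL).congr fun T => ?_)
    (hsum.hasSum.comp hZ)
  have : Finite {ρ : ℂ // S.xi ρ = 0 ∧ |ρ.im| ≤ T} := hfin T
  have := Fintype.ofFinite {ρ : ℂ // S.xi ρ = 0 ∧ |ρ.im| ≤ T}
  simp only [Function.comp_apply, tsum_fintype, Complex.re_sum, ← Complex.ofReal_natCast,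
    Complex.re_ofReal_mul]
  exact Finset.sum_bij (fun ρ _ => ⟨ρ, ρ.2.1⟩) (fun ρ _ => by simpa [Z] using ρ.2)
    (fun ρ _ ρ' _ h => Subtype.ext (congrArg (fun x : {ρ // S.xi ρ = 0} => (x : ℂ)) h))
    (fun ρ hρ => ⟨⟨ρ, by simpa [Z] using hρ⟩, Finset.mem_univ _, rfl⟩) fun ρ _ => rfl

end
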